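/- arXiv:1209.0527 — 3 statements merged into one kernel-verified Lean document; each statement's English description precedes it below -/
import Mathlib

section
/- Let M ≥ 2, u' ∈ ℝ³ and u_th' > 0, and let f : ℝ³ → ℝ be a finite Hermite expansion f(v) = Σ_{|α| ≤ M} f'_α 𝓗_{u_th',α}(ξ'), with ξ' = (v − u')/√u_th'. Let ρ, u, u_th denote the density, macroscopic velocity and thermal velocity of f, and assume ρ > 0. Then: (i) ρ = f'_0; (ii) ρ u_d = ρ u'_d + f'_{e_d} for d = 1,2,3; and (iii) ρ|u|² + 3ρ u_th = 2ρ u·u' − ρ|u'|² + Σ_{d=1}^{3} ( u_th' f'_0 + 2 f'_{2e_d} ). -/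
open MeasureTheory Real

/-- Probabilists' Hermite polynomial `He_n(x) = (-1)^n e^{x²/2} dⁿ/dxⁿ e^{-x²/2}`,
extended by `0` for negative indices. -/
noncomputable def He (n : ℤ) (x : ℝ) : ℝ :=
  if n < 0 then 0
  else (-1 : ℝ) ^ n.toNat * Real.exp (x ^ 2 / 2) *
    iteratedDeriv n.toNat (fun y => Real.exp (-(y ^ 2) / 2)) x

/-- Hermite basis function `𝓗_{uth,α}(ξ)`; it vanishes whenever a component of
the multi-index `α` is negative. -/
noncomputable def hermiteH (uth : ℝ) (α : Fin 3 → ℤ) (ξ : Fin 3 → ℝ) : ℝ :=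
  ∏ d : Fin 3, (Real.sqrt (2 * π))⁻¹ * uth ^ ((-(α d : ℝ) - 1) / 2) *
    He (α d) (ξ d) * Real.exp (-(ξ d) ^ 2 / 2)

/-- The set of multi-indices `α ∈ ℕ³` with `|α| ≤ M`. -/
def multiIndices (M : ℕ) : Finset (Fin 3 → ℕ) :=
  (Finset.Icc 0 fun _ => M).filter fun α => ∑ d, α d ≤ M

open Polynomial in
/-- The Gaussian integral `∫ p(x) e^{-x²/2} dx` of a real polynomial `p`. -/
noncomputable def gaussianMoment (p : ℝ[X]) : ℝ :=
  ∫ x, p.eval x * Real.exp (-x ^ 2 / 2)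

section GaussianMoment

open Polynomial

theorem integrable_polynomial_mul_exp_neg_sq (p : ℝ[X]) :
    Integrable fun x : ℝ => p.eval x * Real.exp (-x ^ 2 / 2) := by
  induction p using Polynomial.induction_on' with
  | add p q hp hq =>
    simp only [eval_add, add_mul]
    exact hp.add hq
  | monomial n a =>
    have h := (integrable_rpow_mul_exp_neg_mul_sq (b := 1 / 2) (by norm_num)
      (s := n) (by linarith [n.cast_nonneg (α := ℝ)])).const_mul a
    refine h.congr (ae_of_all _ fun x => ?_)
    simp only [eval_monomial, Real.rpow_natCast]
    rw [mul_assoc]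
    ring_nf

theorem gaussianMoment_add (p q : ℝ[X]) :
    gaussianMoment (p + q) = gaussianMoment p + gaussianMoment q := by
  simp only [gaussianMoment, eval_add, add_mul]
  exact integral_add (integrable_polynomial_mul_exp_neg_sq p)
    (integrable_polynomial_mul_exp_neg_sq q)

theorem gaussianMoment_sub (p q : ℝ[X]) :
    gaussianMoment (p - q) = gaussianMoment p - gaussianMoment q := by
  simp only [gaussianMoment, eval_sub, sub_mul]
  exact integral_sub (integrable_polynomial_mul_exp_neg_sq p)
    (integrable_polynomial_mul_exp_neg_sq q)

theorem gaussianMoment_C_mul (a : ℝ) (p : ℝ[X]) :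
    gaussianMoment (C a * p) = a * gaussianMoment p := by
  simp only [gaussianMoment, eval_mul, eval_C, mul_assoc]
  exact integral_const_mul _ _

theorem gaussianMoment_zero : gaussianMoment 0 = 0 := by
  simp [gaussianMoment]

theorem gaussianMoment_one : gaussianMoment 1 = √(2 * π) := by
  have h := integral_gaussian (1 / 2)
  simp only [gaussianMoment, eval_one, one_mul]
  convert h using 2
  · ext x
    ring_nf
  · ring

theorem gaussianMoment_X_mul (p : ℝ[X]) :
    gaussianMoment (X * p) = gaussianMoment (derivative p) := by
  have h : gaussianMoment (derivative p - X * p) = 0 := by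
    refine integral_eq_zero_of_hasDerivAt_of_integrable (fun x => ?_)
      (integrable_polynomial_mul_exp_neg_sq _) (integrable_polynomial_mul_exp_neg_sq p)
    have h2 : HasDerivAt (fun y : ℝ => -y ^ 2 / 2) (-x) x := by
      have := ((hasDerivAt_pow 2 x).neg).div_const 2
      exact this.congr_deriv (by norm_num; ring)
    refine ((p.hasDerivAt x).mul h2.exp).congr_deriv ?_
    simp only [eval_sub, eval_mul, eval_X]
    ring
  rw [gaussianMoment_sub] at h
  linarith

theorem gaussianMoment_hermite_mul (n : ℕ) (p : ℝ[X]) :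
    gaussianMoment ((hermite n).map (Int.castRingHom ℝ) * p) =
      gaussianMoment (derivative^[n] p) := by
  induction n generalizing p with
  | zero => simp
  | succ n ih =>
    rw [Function.iterate_succ_apply, ← ih, hermite_succ]
    have h : (X * hermite n - derivative (hermite n)).map (Int.castRingHom ℝ) * p =
        X * ((hermite n).map (Int.castRingHom ℝ) * p) -
          derivative ((hermite n).map (Int.castRingHom ℝ)) * p := by
      simp only [Polynomial.map_sub, Polynomial.map_mul, map_X, derivative_map]
      ring
    rw [h, gaussianMoment_sub, gaussianMoment_X_mul, ← gaussianMoment_sub, derivative_mul]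
    congr 1
    ring

theorem He_natCast (n : ℕ) (x : ℝ) :
    He n x = ((hermite n).map (Int.castRingHom ℝ)).eval x := by
  have h := hermite_eq_deriv_gaussian' n x
  have hg : (fun y : ℝ => Real.exp (-(y ^ 2 / 2))) = fun y => Real.exp (-(y ^ 2) / 2) := by
    ext y
    rw [neg_div]
  rw [hg] at h
  rw [He, if_neg (by simp), eval_map, ← algebraMap_int_eq, ← aeval_def, h, iteratedDeriv_eq_iterate,
    Int.toNat_natCast]
  ring

end GaussianMoment

/-- One-dimensional factor of `hermiteH` in the physical variable `v`, centred at `a`. -/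
noncomputable def hermiteFactor (s a : ℝ) (n : ℕ) (v : ℝ) : ℝ :=
  (√(2 * π))⁻¹ * s ^ ((-(n : ℝ) - 1) / 2) * He n ((v - a) / √s) *
    Real.exp (-((v - a) / √s) ^ 2 / 2)

section HermiteFactor

open Polynomial

theorem pow_mul_hermiteFactor {s : ℝ} (hs : 0 < s) (a : ℝ) (n k : ℕ) (v : ℝ) :
    v ^ k * hermiteFactor s a n v =
      (√(2 * π))⁻¹ * s ^ ((-(n : ℝ) - 1) / 2) *
        (((hermite n).map (Int.castRingHom ℝ) * (C a + C (√s) * X) ^ k).eval ((v - a) / √s) *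
          Real.exp (-((v - a) / √s) ^ 2 / 2)) := by
  have hr : √s ≠ 0 := (Real.sqrt_pos.2 hs).ne'
  have hv : a + √s * ((v - a) / √s) = v := by
    field_simp
    ring
  rw [hermiteFactor, He_natCast]
  simp only [eval_mul, eval_pow, eval_add, eval_C, eval_X, hv]
  ring

theorem integrable_pow_mul_hermiteFactor {s : ℝ} (hs : 0 < s) (a : ℝ) (n k : ℕ) :
    Integrable fun v => v ^ k * hermiteFactor s a n v := by
  simp only [pow_mul_hermiteFactor hs]
  exact (((integrable_polynomial_mul_exp_neg_sq _).comp_div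
    (Real.sqrt_pos.2 hs).ne').comp_sub_right a).const_mul _

theorem integral_pow_mul_hermiteFactor {s : ℝ} (hs : 0 < s) (a : ℝ) (n k : ℕ) :
    ∫ v, v ^ k * hermiteFactor s a n v =
      (√(2 * π))⁻¹ * ((√s)⁻¹ ^ n *
        gaussianMoment (derivative^[n] ((C a + C (√s) * X) ^ k))) := by
  have hr : 0 < √s := Real.sqrt_pos.2 hs
  simp only [pow_mul_hermiteFactor hs]
  rw [integral_const_mul]
  have hsub (p : ℝ[X]) : ∫ v, p.eval ((v - a) / √s) * Real.exp (-((v - a) / √s) ^ 2 / 2) =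
      √s * gaussianMoment p := by
    rw [integral_sub_right_eq_self
        (fun v : ℝ => p.eval (v / √s) * Real.exp (-(v / √s) ^ 2 / 2)) a,
      Measure.integral_comp_div (fun v : ℝ => p.eval v * Real.exp (-v ^ 2 / 2)),
      abs_of_pos hr, smul_eq_mul, gaussianMoment]
  rw [hsub, gaussianMoment_hermite_mul]
  have hp : s ^ ((-(n : ℝ) - 1) / 2) * √s = (√s)⁻¹ ^ n := by
    rw [Real.sqrt_eq_rpow, ← Real.rpow_add hs, ← Real.rpow_neg hs.le, ← Real.rpow_mul_natCast hs.le]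
    congr 1
    ring
  rw [← hp]
  ring

theorem integral_hermiteFactor {s : ℝ} (hs : 0 < s) (a : ℝ) (n : ℕ) :
    ∫ v, v ^ 0 * hermiteFactor s a n v = if n = 0 then 1 else 0 := by
  have hpi : √(2 * π) ≠ 0 := by positivity
  rw [integral_pow_mul_hermiteFactor hs]
  match n with
  | 0 =>
    simp only [pow_zero, Function.iterate_zero, id_eq, gaussianMoment_one, one_mul, if_true]
    exact inv_mul_cancel₀ hpi
  | n + 1 => simp [gaussianMoment_zero]

theorem integral_id_mul_hermiteFactor {s : ℝ} (hs : 0 < s) (a : ℝ) (n : ℕ) :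
    ∫ v, v ^ 1 * hermiteFactor s a n v = if n = 0 then a else if n = 1 then 1 else 0 := by
  have hpi : √(2 * π) ≠ 0 := by positivity
  have hr : √s ≠ 0 := (Real.sqrt_pos.2 hs).ne'
  rw [integral_pow_mul_hermiteFactor hs]
  have hX : gaussianMoment X = 0 := by
    simpa [gaussianMoment_zero] using gaussianMoment_X_mul 1
  have hC (b : ℝ) : gaussianMoment (C b) = b * √(2 * π) := by
    simpa [gaussianMoment_one] using gaussianMoment_C_mul b 1
  match n with
  | 0 =>
    simp [gaussianMoment_add, gaussianMoment_C_mul, hX, hC]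
    field_simp
  | 1 =>
    simp [hC]
    field_simp
  | n + 2 => simp [gaussianMoment_zero]

theorem integral_sq_mul_hermiteFactor {s : ℝ} (hs : 0 < s) (a : ℝ) (n : ℕ) :
    ∫ v, v ^ 2 * hermiteFactor s a n v =
      if n = 0 then a ^ 2 + s else if n = 1 then 2 * a else if n = 2 then 2 else 0 := by
  have hpi : √(2 * π) ≠ 0 := by positivity
  have hr : √s ≠ 0 := (Real.sqrt_pos.2 hs).ne'
  have hss : √s ^ 2 = s := Real.sq_sqrt hs.le
  rw [integral_pow_mul_hermiteFactor hs]
  have hX : gaussianMoment X = 0 := by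
    simpa [gaussianMoment_zero] using gaussianMoment_X_mul 1
  have hXX : gaussianMoment (X * X) = √(2 * π) := by
    simpa [gaussianMoment_one] using gaussianMoment_X_mul X
  have hC (b : ℝ) : gaussianMoment (C b) = b * √(2 * π) := by
    simpa [gaussianMoment_one] using gaussianMoment_C_mul b 1
  have h0 : (C a + C (√s) * X) ^ 2 = C (a ^ 2) + (C (2 * a * √s) * X + C (√s ^ 2) * (X * X)) := by
    simp only [map_mul, map_pow, map_ofNat]
    ring
  have h1 : derivative ((C a + C (√s) * X) ^ 2) = C (2 * a * √s) + C (2 * √s ^ 2) * X := by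
    rw [h0]
    simp only [derivative_add, derivative_mul, derivative_C, derivative_X, map_mul, map_pow,
      map_ofNat]
    simp [derivative_pow]
    ring
  match n with
  | 0 =>
    simp only [Function.iterate_zero, id_eq, h0, gaussianMoment_add, gaussianMoment_C_mul, hX,
      hXX, hC, hss]
    simp
    field_simp
  | 1 =>
    simp only [Function.iterate_one, h1, gaussianMoment_add, gaussianMoment_C_mul, hX, hC]
    simp
    field_simp
  | 2 =>
    simp only [Function.iterate_succ_apply, Function.iterate_zero, id_eq, h1, derivative_add,
      derivative_C, derivative_C_mul, derivative_X, zero_add, mul_one, hC]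
    simp
    field_simp
  | n + 3 =>
    simp only [Function.iterate_succ_apply, h1, derivative_add, derivative_C, derivative_C_mul,
      derivative_X, zero_add, mul_one, iterate_derivative_zero, gaussianMoment_zero]
    simp

end HermiteFactor

theorem pow_mul_hermiteH_eq_prod (s : ℝ) (a : Fin 3 → ℝ) (d : Fin 3) (k : ℕ) (α : Fin 3 → ℕ)
    (v : Fin 3 → ℝ) :
    v d ^ k * hermiteH s (fun i => (α i : ℤ)) (fun i => (v i - a i) / √s) =
      ∏ i, v i ^ (if i = d then k else 0) * hermiteFactor s (a i) (α i) (v i) := by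
  have h : ∏ i, v i ^ (if i = d then k else 0) = v d ^ k := by
    rw [Finset.prod_eq_single d (fun i _ hi => by simp [hi]) (by simp)]
    simp
  rw [Finset.prod_mul_distrib, h, hermiteH]
  simp [hermiteFactor]

theorem integrable_pow_mul_hermiteH {s : ℝ} (hs : 0 < s) (a : Fin 3 → ℝ) (d : Fin 3) (k : ℕ)
    (α : Fin 3 → ℕ) :
    Integrable fun v : Fin 3 → ℝ =>
      v d ^ k * hermiteH s (fun i => (α i : ℤ)) (fun i => (v i - a i) / √s) := by
  simp only [pow_mul_hermiteH_eq_prod]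
  exact Integrable.fintype_prod fun i => integrable_pow_mul_hermiteFactor hs (a i) (α i) _

theorem integral_pow_mul_hermiteH {s : ℝ} (hs : 0 < s) (a : Fin 3 → ℝ) (d : Fin 3) (k : ℕ)
    (α : Fin 3 → ℕ) :
    ∫ v : Fin 3 → ℝ, v d ^ k * hermiteH s (fun i => (α i : ℤ)) (fun i => (v i - a i) / √s) =
      ∏ i, if i = d then ∫ x, x ^ k * hermiteFactor s (a d) (α d) x
        else if α i = 0 then 1 else 0 := by
  simp only [pow_mul_hermiteH_eq_prod]
  rw [integral_fintype_prod_volume_eq_prod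
    (fun i x => x ^ (if i = d then k else 0) * hermiteFactor s (a i) (α i) x)]
  refine Finset.prod_congr rfl fun i _ => ?_
  by_cases hi : i = d
  · subst hi
    simp
  · simp only [if_neg hi]
    exact integral_hermiteFactor hs (a i) (α i)

theorem sum_multiIndices_mul_prod (M : ℕ) (hM : 2 ≤ M) (c : (Fin 3 → ℕ) → ℝ) (d : Fin 3)
    (F : ℕ → ℝ) (hF : ∀ n, 3 ≤ n → F n = 0) :
    ∑ α ∈ multiIndices M, c α * ∏ i, (if i = d then F (α d) else if α i = 0 then 1 else 0) =
      ∑ m ∈ Finset.range 3, c (fun j => if j = d then m else 0) * F m := by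
  symm
  refine Finset.sum_of_injOn (fun m j => if j = d then m else 0) ?_ ?_ ?_ ?_
  · intro m _ n _ h
    simpa using congrFun h d
  · intro m hm
    have hm' : m < 3 := by simpa using hm
    simp only [multiIndices, Finset.coe_filter, Finset.mem_Icc, Set.mem_ofPred_eq]
    refine ⟨⟨fun i => Nat.zero_le _, fun i => ?_⟩, ?_⟩
    · dsimp only
      split_ifs <;> omega
    · simp only [Finset.sum_ite_eq', Finset.mem_univ, if_true]
      omega
  · intro α _ hα
    refine mul_eq_zero_of_right _ ?_
    by_cases h : ∀ i, i ≠ d → α i = 0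
    · refine Finset.prod_eq_zero (Finset.mem_univ d) ?_
      rw [if_pos rfl]
      refine hF _ ?_
      by_contra! hlt
      refine hα ⟨α d, by simpa using hlt, ?_⟩
      ext j
      by_cases hj : j = d
      · simp [hj]
      · simp [hj, h j hj]
    · push Not at h
      obtain ⟨i, hi, hαi⟩ := h
      exact Finset.prod_eq_zero (Finset.mem_univ i) (by simp [hi, hαi])
  · intro m _
    congr 1
    rw [Finset.prod_eq_single d (fun i _ hi => by simp [hi]) (by simp)]
    simp

section HermiteExpansion

variable {M : ℕ} {s : ℝ} {a : Fin 3 → ℝ} {c : (Fin 3 → ℕ) → ℝ} {f : (Fin 3 → ℝ) → ℝ}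

theorem integrable_pow_mul_hermiteExpansion (hs : 0 < s)
    (hf : ∀ v, f v = ∑ α ∈ multiIndices M, c α *
      hermiteH s (fun d => (α d : ℤ)) (fun d => (v d - a d) / √s)) (d : Fin 3) (k : ℕ) :
    Integrable fun v : Fin 3 → ℝ => v d ^ k * f v := by
  simp only [hf, Finset.mul_sum, mul_left_comm _ (c _)]
  exact integrable_finsetSum _ fun α _ => (integrable_pow_mul_hermiteH hs a d k α).const_mul _

theorem integral_pow_mul_hermiteExpansion (hM : 2 ≤ M) (hs : 0 < s)
    (hf : ∀ v, f v = ∑ α ∈ multiIndices M, c α *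
      hermiteH s (fun d => (α d : ℤ)) (fun d => (v d - a d) / √s)) (d : Fin 3) (k : ℕ)
    (hk : ∀ n, 3 ≤ n → ∫ x, x ^ k * hermiteFactor s (a d) n x = 0) :
    ∫ v : Fin 3 → ℝ, v d ^ k * f v = ∑ m ∈ Finset.range 3,
      c (fun j => if j = d then m else 0) * ∫ x, x ^ k * hermiteFactor s (a d) m x := by
  rw [← sum_multiIndices_mul_prod M hM c d _ hk]
  simp only [hf, Finset.mul_sum, mul_left_comm _ (c _)]
  rw [integral_finsetSum _ fun α _ => (integrable_pow_mul_hermiteH hs a d k α).const_mul _]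
  simp only [integral_const_mul, integral_pow_mul_hermiteH hs]

end HermiteExpansion

/-- Relations (similar-relations) between the moments of a finite Hermite
expansion around `(u', uth')` and its expansion coefficients. -/
theorem moments_of_hermite_expansion
    (M : ℕ) (hM : 2 ≤ M)
    (u' : Fin 3 → ℝ) (uth' : ℝ) (huth' : 0 < uth')
    (c : (Fin 3 → ℕ) → ℝ) (f : (Fin 3 → ℝ) → ℝ)
    -- `f` is the finite Hermite expansion with coefficients `c α = f'_α`
    (hf : ∀ v, f v = ∑ α ∈ multiIndices M, c α *
      hermiteH uth' (fun d => (α d : ℤ)) (fun d => (v d - u' d) / Real.sqrt uth'))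
    (ρ : ℝ) (u : Fin 3 → ℝ) (uth : ℝ)
    (hρpos : 0 < ρ)
    -- `ρ, u, uth` are the density, macroscopic velocity and thermal velocity of `f`
    (hρ : ρ = ∫ v, f v)
    (hu : ∀ d, ρ * u d = ∫ v, v d * f v)
    (huth : ρ * (∑ d, u d ^ 2) + 3 * ρ * uth = ∫ v, (∑ d, v d ^ 2) * f v) :
    ρ = c 0 ∧
    (∀ d : Fin 3, ρ * u d = ρ * u' d + c (fun j => if j = d then 1 else 0)) ∧
    ρ * (∑ d, u d ^ 2) + 3 * ρ * uth =
      2 * ρ * (∑ d, u d * u' d) - ρ * (∑ d, u' d ^ 2) +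
        ∑ d : Fin 3, (uth' * c 0 + 2 * c fun j => if j = d then 2 else 0) := by
  have hc0 (d : Fin 3) : c (fun j => if j = d then 0 else 0) = c 0 := by
    congr 1
    ext j
    simp
  have h0 : ρ = c 0 := by
    have h := integral_pow_mul_hermiteExpansion hM huth' hf 0 0 fun n hn => by
      rw [integral_hermiteFactor huth', if_neg (by omega)]
    simp only [integral_hermiteFactor huth', Finset.sum_range_succ, Finset.sum_range_zero, hc0] at h
    rw [hρ]
    simpa using h
  have h1 (d : Fin 3) : ρ * u d = ρ * u' d + c (fun j => if j = d then 1 else 0) := by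
    have h := integral_pow_mul_hermiteExpansion hM huth' hf d 1 fun n hn => by
      rw [integral_id_mul_hermiteFactor huth', if_neg (by omega), if_neg (by omega)]
    simp only [integral_id_mul_hermiteFactor huth', Finset.sum_range_succ,
      Finset.sum_range_zero, hc0] at h
    rw [hu, h0]
    simpa using h
  have h2 (d : Fin 3) : ∫ v, v d ^ 2 * f v = ρ * (u' d ^ 2 + uth') +
      2 * u' d * c (fun j => if j = d then 1 else 0) +
        2 * c (fun j => if j = d then 2 else 0) := by
    have h := integral_pow_mul_hermiteExpansion hM huth' hf d 2 fun n hn => by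
      rw [integral_sq_mul_hermiteFactor huth', if_neg (by omega), if_neg (by omega),
        if_neg (by omega)]
    simp only [integral_sq_mul_hermiteFactor huth', Finset.sum_range_succ,
      Finset.sum_range_zero, hc0] at h
    rw [h, h0]
    norm_num
    ring
  refine ⟨h0, h1, ?_⟩
  rw [huth]
  simp only [Finset.sum_mul]
  rw [integral_finsetSum _ fun d _ => integrable_pow_mul_hermiteExpansion huth' hf d 2]
  simp only [h2, Finset.mul_sum, ← Finset.sum_sub_distrib, ← Finset.sum_add_distrib]
  refine Finset.sum_congr rfl fun d _ => ?_
  rw [← h0]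
  linear_combination (-2 * u' d) * h1 d
end

section
/- Let f : ℝ × ℝ³ × ℝ³ → ℝ be a C¹ solution of the Vlasov–Poisson–BGK equation ∂f/∂t + v·∇_x f + F·∇_v f = ν(f_M − f), where F(t,x) does not depend on v, ν ≥ 0 is constant, and f_M(t,x,·) is the local Maxwellian built from the density ρ(t,x) > 0, macroscopic velocity u(t,x) and thermal velocity u_th(t,x) of f(t,x,·). Assume f(t,x,·) and its derivatives decay rapidly in v, and ρ, u, u_th, the pressure tensor p_{ij} = ∫ (v_i−u_i)(v_j−u_j) f dv and the heat flux q_j = (1/2)∫ |v−u|²(v_j−u_j) f dv are C¹. Then the thermal-velocity (energy) balance holds pointwise: ρ ( ∂u_th/∂t + Σ_{j=1}^{3} u_j ∂u_th/∂x_j ) + (2/3) Σ_{j=1}^{3} ( ∂q_j/∂x_j + Σ_{d=1}^{3} p_{jd} ∂u_d/∂x_j ) = 0. -/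
open MeasureTheory Real

/-- The local Maxwellian built from density `ρ`, macroscopic velocity `u`
and thermal velocity `uth`. -/
noncomputable def maxwellian (ρ : ℝ) (u : Fin 3 → ℝ) (uth : ℝ) (v : Fin 3 → ℝ) : ℝ :=
  ρ * (2 * π * uth) ^ (-(3 : ℝ) / 2) * Real.exp (-(∑ d, (v d - u d) ^ 2) / (2 * uth))

/-- Partial derivative of `g : ℝ³ → ℝ` in the `i`-th coordinate direction at `x`. -/
noncomputable def pd (i : Fin 3) (g : (Fin 3 → ℝ) → ℝ) (x : Fin 3 → ℝ) : ℝ :=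
  deriv (fun s => g (Function.update x i s)) (x i)

section Transport

variable {E Y ι : Type*} [NormedAddCommGroup E] [NormedSpace ℝ E] [FiniteDimensional ℝ E]
  [MeasurableSpace E] [BorelSpace E] {μ : Measure E} [μ.IsAddHaarMeasure]

theorem integral_mul_fderiv_eq_neg_of_hasCompactSupport {ψ h : E → ℝ} (hψ : ContDiff ℝ 1 ψ)
    (hc : HasCompactSupport ψ) (hh : ContDiff ℝ 1 h) (e : E) :
    ∫ z, ψ z * fderiv ℝ h z e ∂μ = -∫ z, fderiv ℝ ψ z e * h z ∂μ := by
  have hψ' : Continuous fun z => fderiv ℝ ψ z e :=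
    (hψ.continuous_fderiv one_ne_zero).clm_apply continuous_const
  have hh' : Continuous fun z => fderiv ℝ h z e :=
    (hh.continuous_fderiv one_ne_zero).clm_apply continuous_const
  refine integral_mul_fderiv_eq_neg_fderiv_mul_of_integrable ?_ ?_ ?_
    (fun z _ => (hψ.differentiable one_ne_zero) z) (fun z _ => (hh.differentiable one_ne_zero) z)
  · exact (hψ'.mul hh.continuous).integrable_of_hasCompactSupport
      ((hc.fderiv_apply (𝕜 := ℝ) e).mul_right)
  · exact (hψ.continuous.mul hh').integrable_of_hasCompactSupport hc.mul_right
  · exact (hψ.continuous.mul hh.continuous).integrable_of_hasCompactSupport hc.mul_right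

variable [TopologicalSpace Y] [SecondCountableTopology Y] [MeasurableSpace Y]
  [OpensMeasurableSpace Y] {κ : Measure Y}

theorem integrable_mul_of_dominated_on_tsupport {E Y : Type*} [NormedAddCommGroup E]
    [MeasurableSpace E] [BorelSpace E] {μ : Measure E} [μ.IsAddHaarMeasure] [TopologicalSpace Y]
    [SecondCountableTopology Y] [MeasurableSpace Y] [OpensMeasurableSpace Y] {κ : Measure Y}
    {χ : E → ℝ} {k : E → Y → ℝ} {b : Y → ℝ}
    (hχ : Continuous χ) (hc : HasCompactSupport χ) (hk : Continuous (Function.uncurry k))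
    (hb : Integrable b κ) (hkb : ∀ z ∈ tsupport χ, ∀ y, |k z y| ≤ b y) :
    Integrable (Function.uncurry fun z y => χ z * k z y) (μ.prod κ) := by
  have hdom : Integrable (fun w : E × Y => |χ w.1| * b w.2) (μ.prod κ) :=
    Integrable.mul_prod (hχ.integrable_of_hasCompactSupport hc).abs hb
  refine hdom.mono' ?_ (ae_of_all _ fun w => ?_)
  · exact ((hχ.comp continuous_fst).mul hk).aestronglyMeasurable
  · by_cases hw : w.1 ∈ tsupport χ
    · simpa [Function.uncurry, abs_mul] using
        mul_le_mul_of_nonneg_left (hkb _ hw w.2) (abs_nonneg (χ w.1))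
    · simp [Function.uncurry, image_eq_zero_of_notMem_tsupport hw]

/-- If the moments `∫ wᵢ g` are `C¹` and the transport derivative `∑ wᵢ ∂ᵢ g` is dominated, then
integration commutes with the transport derivative, even though the individual terms `wᵢ ∂ᵢ g`
need not be integrable. -/
theorem sum_fderiv_integral_eq_integral_sum_fderiv [SFinite κ] [Fintype ι] {e : ι → E}
    {w : ι → Y → ℝ} {g : E → Y → ℝ} {b : Y → ℝ} {U : Set E} (hU : IsOpen U)
    (hw : ∀ i, Continuous (w i))
    (hg : Continuous (Function.uncurry g)) (hgd : ∀ y, ContDiff ℝ 1 fun z => g z y)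
    (hg' : ∀ i, Continuous fun q : E × Y => fderiv ℝ (fun z => g z q.2) q.1 (e i))
    (hb : Integrable b κ) (hb0 : ∀ z ∈ U, ∀ y i, |w i y * g z y| ≤ b y)
    (hb1 : ∀ z ∈ U, ∀ y, |∑ i, w i y * fderiv ℝ (fun z => g z y) z (e i)| ≤ b y)
    (hm : ∀ i, ContDiff ℝ 1 fun z => ∫ y, w i y * g z y ∂κ) {z : E} (hz : z ∈ U) :
    ∑ i, fderiv ℝ (fun z => ∫ y, w i y * g z y ∂κ) z (e i)
      = ∫ y, ∑ i, w i y * fderiv ℝ (fun z => g z y) z (e i) ∂κ := by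
  obtain ⟨μ, _⟩ : ∃ μ : Measure E, μ.IsAddHaarMeasure := ⟨Measure.addHaar, inferInstance⟩
  have hD : Continuous (Function.uncurry fun z y =>
      ∑ i, w i y * fderiv ℝ (fun z => g z y) z (e i)) :=
    continuous_finsetSum _ fun i _ => ((hw i).comp continuous_snd).mul (hg' i)
  have hL : ∀ i, Continuous fun z => fderiv ℝ (fun z => ∫ y, w i y * g z y ∂κ) z (e i) :=
    fun i => ((hm i).continuous_fderiv one_ne_zero).clm_apply continuous_const
  have hLs : Continuous fun z => ∑ i, fderiv ℝ (fun z => ∫ y, w i y * g z y ∂κ) z (e i) :=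
    continuous_finsetSum _ fun i _ => hL i
  have hR : ContinuousOn
      (fun z => ∫ y, ∑ i, w i y * fderiv ℝ (fun z => g z y) z (e i) ∂κ) U :=
    continuousOn_of_dominated
      (fun z _ => (hD.comp (Continuous.prodMk_right z)).aestronglyMeasurable)
      (fun z hz => ae_of_all _ (hb1 z hz)) hb
      (ae_of_all _ fun y => (hD.comp (Continuous.prodMk_left y)).continuousOn)
  have hae := hU.ae_eq_zero_of_integral_contDiff_smul_eq_zero (μ := μ)
    ((hLs.continuousOn.sub hR).locallyIntegrableOn hU.measurableSet) ?_
  · refine Measure.eqOn_open_of_ae_eq (μ := μ) ?_ hU hLs.continuousOn hR hz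
    rw [Filter.EventuallyEq, ae_restrict_iff' hU.measurableSet]
    filter_upwards [hae] with z hz hzU using sub_eq_zero.1 (hz hzU)
  intro ψ hψ hc hψU
  have hψ1 : ContDiff ℝ 1 ψ := hψ.of_le (by exact_mod_cast le_top)
  have hψ' : ∀ i, Continuous fun z => fderiv ℝ ψ z (e i) := fun i =>
    (hψ1.continuous_fderiv one_ne_zero).clm_apply continuous_const
  have hc' : ∀ i, HasCompactSupport fun z => fderiv ℝ ψ z (e i) := fun i =>
    hc.fderiv_apply (𝕜 := ℝ) (e i)
  have hFub : ∀ i, Integrable (Function.uncurry fun z y => fderiv ℝ ψ z (e i) * (w i y * g z y))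
      (μ.prod κ) := fun i =>
    integrable_mul_of_dominated_on_tsupport (hψ' i) (hc' i)
      (((hw i).comp continuous_snd).mul hg) hb
      fun z hz y => hb0 z (hψU (tsupport_fderiv_apply_subset ℝ (e i) hz)) y i
  have hFubY : ∀ i, Integrable (fun y => ∫ z, fderiv ℝ ψ z (e i) * (w i y * g z y) ∂μ) κ :=
    fun i => (hFub i).integral_prod_right
  have hFubD := integrable_mul_of_dominated_on_tsupport (μ := μ) hψ1.continuous hc hD hb
    fun z hz y => hb1 z (hψU hz) y
  have hterm : ∀ i y, ∫ z, fderiv ℝ ψ z (e i) * (w i y * g z y) ∂μ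
      = -∫ z, ψ z * (w i y * fderiv ℝ (fun z => g z y) z (e i)) ∂μ := by
    intro i y
    have := integral_mul_fderiv_eq_neg_of_hasCompactSupport (μ := μ) hψ1 hc (hgd y) (e i)
    simp_rw [mul_left_comm _ (w i y), integral_const_mul, this]
    ring
  have hψL : ∀ i, Integrable (fun z => ψ z *
      fderiv ℝ (fun z => ∫ y, w i y * g z y ∂κ) z (e i)) μ := fun i =>
    (hψ1.continuous.mul (hL i)).integrable_of_hasCompactSupport hc.mul_right
  have hψD : ∀ y i, Integrable (fun z => ψ z * (w i y * fderiv ℝ (fun z => g z y) z (e i))) μ :=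
    fun y i => (hψ1.continuous.mul (continuous_const.mul
      ((hg' i).comp (Continuous.prodMk_left y)))).integrable_of_hasCompactSupport hc.mul_right
  have key : ∫ z, ψ z * ∑ i, fderiv ℝ (fun z => ∫ y, w i y * g z y ∂κ) z (e i) ∂μ
      = ∫ z, ψ z * ∫ y, ∑ i, w i y * fderiv ℝ (fun z => g z y) z (e i) ∂κ ∂μ := by
    simp_rw [← integral_const_mul]
    rw [integral_integral_swap hFubD]
    simp_rw [Finset.mul_sum]
    rw [integral_finsetSum _ fun i _ => hψL i]
    have h1 : ∀ y, ∫ z, ∑ i, ψ z * (w i y * fderiv ℝ (fun z => g z y) z (e i)) ∂μ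
        = -∑ i, ∫ z, fderiv ℝ ψ z (e i) * (w i y * g z y) ∂μ := by
      intro y
      rw [integral_finsetSum _ fun i _ => hψD y i, ← Finset.sum_neg_distrib]
      exact Finset.sum_congr rfl fun i _ => by rw [hterm, neg_neg]
    simp_rw [h1]
    rw [integral_neg, integral_finsetSum _ fun i _ => hFubY i,
      ← Finset.sum_neg_distrib]
    refine Finset.sum_congr rfl fun i _ => ?_
    rw [integral_mul_fderiv_eq_neg_of_hasCompactSupport hψ1 hc (hm i) (e i)]
    rw [← integral_integral_swap (hFub i)]
    simp_rw [integral_const_mul]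
  have hψR : Integrable (fun z => ψ z * ∫ y, ∑ i, w i y * fderiv ℝ (fun z => g z y) z (e i) ∂κ)
      μ := by
    have := hFubD.integral_prod_left
    simpa only [Function.uncurry, integral_const_mul] using this
  have hψLs : Integrable (fun z => ψ z *
      ∑ i, fderiv ℝ (fun z => ∫ y, w i y * g z y ∂κ) z (e i)) μ :=
    (hψ1.continuous.mul hLs).integrable_of_hasCompactSupport hc.mul_right
  simp_rw [smul_eq_mul, Pi.sub_apply, mul_sub]
  rw [integral_sub hψLs hψR, key, sub_self]

end Transport

section VelocityMoments

theorem integrable_inv_one_add_norm_pow_five :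
    Integrable fun v : Fin 3 → ℝ => ((1 + ‖v‖) ^ 5)⁻¹ := by
  have h := integrable_one_add_norm (E := Fin 3 → ℝ) (μ := volume) (r := 5) (by norm_num)
  refine h.congr (ae_of_all _ fun v => ?_)
  have : (0 : ℝ) ≤ 1 + ‖v‖ := by positivity
  simp only [Real.rpow_neg this]
  norm_cast

theorem abs_mul_le_of_weighted_bound {w h A C r : ℝ} (hr : 0 < r) (hA : 0 ≤ A)
    (hw : |w| ≤ A * r ^ 3) (hh : r ^ 8 * |h| ≤ C) : |w * h| ≤ A * C * (r ^ 5)⁻¹ := by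
  rw [← div_eq_mul_inv, le_div_iff₀ (by positivity), abs_mul]
  calc |w| * |h| * r ^ 5 ≤ A * r ^ 3 * |h| * r ^ 5 := by gcongr
    _ = A * (r ^ 8 * |h|) := by ring
    _ ≤ A * C := by gcongr

theorem integrable_mul_of_weighted_bound {w h : (Fin 3 → ℝ) → ℝ} {A C : ℝ} (hA : 0 ≤ A)
    (hw : Continuous w) (hh : Continuous h) (hwA : ∀ v, |w v| ≤ A * (1 + ‖v‖) ^ 3)
    (hhC : ∀ v, (1 + ‖v‖) ^ 8 * |h v| ≤ C) : Integrable fun v => w v * h v :=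
  (integrable_inv_one_add_norm_pow_five.const_mul (A * C)).mono'
    (hw.mul hh).aestronglyMeasurable (ae_of_all _ fun v =>
      abs_mul_le_of_weighted_bound (by positivity) hA (hwA v) (hhC v))

theorem abs_apply_le_one_add_norm (v : Fin 3 → ℝ) (i : Fin 3) : |v i| ≤ 1 + ‖v‖ :=
  (norm_le_pi_norm v i).trans (by linarith)

theorem abs_one_le_quadratic (v : Fin 3 → ℝ) : |(1 : ℝ)| ≤ 3 * (1 + ‖v‖) ^ 2 := by
  rw [abs_one]
  nlinarith [norm_nonneg v]

theorem abs_apply_le_quadratic (i : Fin 3) (v : Fin 3 → ℝ) : |v i| ≤ 3 * (1 + ‖v‖) ^ 2 :=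
  (abs_apply_le_one_add_norm v i).trans (by nlinarith [norm_nonneg v])

theorem sum_sq_le (v : Fin 3 → ℝ) : |∑ d, v d ^ 2| ≤ 3 * (1 + ‖v‖) ^ 2 := by
  rw [abs_of_nonneg (by positivity)]
  calc ∑ d, v d ^ 2 ≤ ∑ _d : Fin 3, (1 + ‖v‖) ^ 2 := by
        refine Finset.sum_le_sum fun d _ => ?_
        rw [← sq_abs (v d)]
        gcongr
        exact abs_apply_le_one_add_norm v d
    _ = 3 * (1 + ‖v‖) ^ 2 := by simp

section Moments

variable {h : (Fin 3 → ℝ) → ℝ} {C : ℝ}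

theorem integrable_mul_of_quadratic_bound (hh : Continuous h)
    (hC : ∀ v, (1 + ‖v‖) ^ 8 * |h v| ≤ C) {φ : (Fin 3 → ℝ) → ℝ} (hφ : Continuous φ)
    (hφ3 : ∀ v, |φ v| ≤ 3 * (1 + ‖v‖) ^ 2) : Integrable fun v => φ v * h v := by
  refine integrable_mul_of_weighted_bound zero_le_three hφ hh (fun v => (hφ3 v).trans ?_) hC
  gcongr <;> simp

theorem integrable_coord_mul (hh : Continuous h)
    (hC : ∀ v, (1 + ‖v‖) ^ 8 * |h v| ≤ C) (a : Fin 3) : Integrable fun v => v a * h v := by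
  refine integrable_mul_of_weighted_bound zero_le_one (continuous_apply a) hh (fun v => ?_) hC
  refine (abs_apply_le_one_add_norm v a).trans ?_
  rw [one_mul]
  exact le_self_pow₀ (by simp) (by norm_num)

theorem integrable_coord_mul_coord_mul (hh : Continuous h)
    (hC : ∀ v, (1 + ‖v‖) ^ 8 * |h v| ≤ C) (a b : Fin 3) :
    Integrable fun v => v a * v b * h v := by
  refine integrable_mul_of_weighted_bound zero_le_one (by fun_prop) hh (fun v => ?_) hC
  rw [abs_mul, one_mul]
  calc |v a| * |v b| ≤ (1 + ‖v‖) * (1 + ‖v‖) := by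
        gcongr <;> exact abs_apply_le_one_add_norm v _
    _ = (1 + ‖v‖) ^ 2 := by ring
    _ ≤ (1 + ‖v‖) ^ 3 := by gcongr <;> simp

theorem integrable_coord_sq_mul_coord_mul (hh : Continuous h)
    (hC : ∀ v, (1 + ‖v‖) ^ 8 * |h v| ≤ C) (a b : Fin 3) :
    Integrable fun v => v a ^ 2 * v b * h v := by
  refine integrable_mul_of_weighted_bound zero_le_one (by fun_prop) hh (fun v => ?_) hC
  rw [abs_mul, abs_pow, one_mul]
  calc |v a| ^ 2 * |v b| ≤ (1 + ‖v‖) ^ 2 * (1 + ‖v‖) := by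
        gcongr <;> exact abs_apply_le_one_add_norm v _
    _ = (1 + ‖v‖) ^ 3 := by ring

theorem integrable_of_weighted_bound (hh : Continuous h)
    (hC : ∀ v, (1 + ‖v‖) ^ 8 * |h v| ≤ C) : Integrable h := by
  simpa using integrable_mul_of_quadratic_bound hh hC (φ := fun _ => 1) continuous_const
    abs_one_le_quadratic

theorem integral_coord_mul_coord_mul (hh : Continuous h)
    (hC : ∀ v, (1 + ‖v‖) ^ 8 * |h v| ≤ C) {r : ℝ} {u : Fin 3 → ℝ} (hr : r = ∫ v, h v)
    (hu : ∀ d, r * u d = ∫ v, v d * h v) (i j : Fin 3) :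
    ∫ v, v i * v j * h v = (∫ v, (v i - u i) * (v j - u j) * h v) + r * u i * u j := by
  have e : (fun v : Fin 3 → ℝ => (v i - u i) * (v j - u j) * h v) =
      (fun v => v i * v j * h v) - (fun v => u i * (v j * h v)) - (fun v => u j * (v i * h v))
        + fun v => u i * u j * h v := by
    ext v
    simp only [Pi.add_apply, Pi.sub_apply]
    ring
  have i0 := integrable_of_weighted_bound hh hC
  have i1 := integrable_coord_mul hh hC
  have i2 := integrable_coord_mul_coord_mul hh hC
  rw [e, integral_add' (((i2 i j).sub ((i1 j).const_mul _)).sub ((i1 i).const_mul _))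
      (i0.const_mul _), integral_sub' ((i2 i j).sub ((i1 j).const_mul _)) ((i1 i).const_mul _),
    integral_sub' (i2 i j) ((i1 j).const_mul _)]
  simp_rw [integral_const_mul]
  rw [← hr, ← hu, ← hu]
  ring

theorem integrable_and_integral_sq_sub_mul (hh : Continuous h)
    (hC : ∀ v, (1 + ‖v‖) ^ 8 * |h v| ≤ C) {r : ℝ} {u : Fin 3 → ℝ} (hr : r = ∫ v, h v)
    (hu : ∀ d, r * u d = ∫ v, v d * h v) (d j : Fin 3) :
    Integrable (fun v => (v d - u d) ^ 2 * (v j - u j) * h v) ∧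
    ∫ v, v d ^ 2 * v j * h v = (∫ v, (v d - u d) ^ 2 * (v j - u j) * h v)
      + 2 * u d * (∫ v, (v d - u d) * (v j - u j) * h v) + u j * ∫ v, v d ^ 2 * h v := by
  have i0 := integrable_of_weighted_bound hh hC
  have i1 := integrable_coord_mul hh hC
  have i2 := integrable_coord_mul_coord_mul hh hC
  have i2' : Integrable fun v : Fin 3 → ℝ => v d ^ 2 * h v := by simpa only [sq] using i2 d d
  have i3 := integrable_coord_sq_mul_coord_mul hh hC
  have e : (fun v : Fin 3 → ℝ => (v d - u d) ^ 2 * (v j - u j) * h v) =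
      (fun v => v d ^ 2 * v j * h v) - (fun v => u j * (v d ^ 2 * h v))
        - (fun v => 2 * u d * (v d * v j * h v)) + (fun v => 2 * u d * u j * (v d * h v))
        + (fun v => u d ^ 2 * (v j * h v)) - fun v => u d ^ 2 * u j * h v := by
    ext v
    simp only [Pi.add_apply, Pi.sub_apply]
    ring
  have j1 := (i3 d j).sub (i2'.const_mul (u j))
  have j2 := j1.sub ((i2 d j).const_mul (2 * u d))
  have j3 := j2.add ((i1 d).const_mul (2 * u d * u j))
  have j4 := j3.add ((i1 j).const_mul (u d ^ 2))
  refine ⟨e ▸ j4.sub (i0.const_mul _), ?_⟩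
  rw [e, integral_sub' j4 (i0.const_mul _), integral_add' j3 ((i1 j).const_mul _),
    integral_add' j2 ((i1 d).const_mul _), integral_sub' j1 ((i2 d j).const_mul _),
    integral_sub' (i3 d j) (i2'.const_mul _)]
  simp_rw [integral_const_mul]
  rw [← hr, ← hu, ← hu, integral_coord_mul_coord_mul hh hC hr hu]
  ring

theorem integral_sum_sq_mul_coord_mul (hh : Continuous h)
    (hC : ∀ v, (1 + ‖v‖) ^ 8 * |h v| ≤ C) {r : ℝ} {u : Fin 3 → ℝ} (hr : r = ∫ v, h v)
    (hu : ∀ d, r * u d = ∫ v, v d * h v) (j : Fin 3) :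
    ∫ v, (∑ d, v d ^ 2) * v j * h v
      = (∫ v, (∑ d, (v d - u d) ^ 2) * (v j - u j) * h v)
        + 2 * (∑ d, u d * ∫ v, (v d - u d) * (v j - u j) * h v)
        + u j * ∫ v, (∑ d, v d ^ 2) * h v := by
  have i2 : ∀ d, Integrable fun v : Fin 3 → ℝ => v d ^ 2 * h v := fun d => by
    simpa only [sq] using integrable_coord_mul_coord_mul hh hC d d
  have i3 := integrable_coord_sq_mul_coord_mul hh hC
  have hc := integrable_and_integral_sq_sub_mul hh hC hr hu
  simp_rw [Finset.sum_mul]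
  rw [integral_finsetSum _ fun d _ => i3 d j, integral_finsetSum _ fun d _ => (hc d j).1,
    integral_finsetSum _ fun d _ => i2 d]
  simp_rw [fun d => (hc d j).2, Finset.sum_add_distrib, Finset.mul_sum, mul_assoc]

end Moments

theorem maxwellian_of_nonpos (ρ : ℝ) (u : Fin 3 → ℝ) {θ : ℝ} (hθ : θ ≤ 0) (v : Fin 3 → ℝ) :
    maxwellian ρ u θ v = 0 := by
  have h : (2 * π * θ) ^ (-(3 : ℝ) / 2) = 0 := by
    rcases hθ.lt_or_eq with hθ | rfl
    · rw [Real.rpow_def_of_neg (mul_neg_of_pos_of_neg (by positivity) hθ)]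
      have : Real.cos (-(3 : ℝ) / 2 * π) = 0 := by
        rw [Real.cos_eq_zero_iff]
        exact ⟨-2, by push_cast; ring⟩
      rw [this, mul_zero]
    · rw [mul_zero, Real.zero_rpow (by norm_num)]
  simp [maxwellian, h]

theorem maxwellian_eq_prod (ρ : ℝ) (u : Fin 3 → ℝ) {θ : NNReal} (v : Fin 3 → ℝ) (hθ : 0 < θ) :
    maxwellian ρ u θ v = ρ * ∏ i, ProbabilityTheory.gaussianPDFReal (u i) θ (v i) := by
  have hpos : 0 < 2 * π * (θ : ℝ) := by positivity
  have h : (2 * π * (θ : ℝ)) ^ (-(3 : ℝ) / 2) = (√(2 * π * θ))⁻¹ ^ 3 := by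
    rw [Real.sqrt_eq_rpow, ← Real.rpow_neg hpos.le, ← Real.rpow_mul_natCast hpos.le]
    norm_num
  simp only [maxwellian, h, ProbabilityTheory.gaussianPDFReal, Finset.prod_mul_distrib,
    ← Real.exp_sum, ← Finset.sum_div, Finset.sum_neg_distrib]
  simp [mul_assoc]

theorem integral_coord_mul_maxwellian (ρ : ℝ) (u : Fin 3 → ℝ) {θ : NNReal} (hθ : 0 < θ)
    (k : ℝ → ℝ) (d : Fin 3) : ∫ v, k (v d) * maxwellian ρ u θ v
      = ρ * ∫ x, k x ∂ProbabilityTheory.gaussianReal (u d) θ := by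
  have e : ∀ v : Fin 3 → ℝ, k (v d) * maxwellian ρ u θ v = ρ * ∏ i,
      ProbabilityTheory.gaussianPDFReal (u i) θ (v i) * (if i = d then k (v i) else 1) := by
    intro v
    rw [maxwellian_eq_prod ρ u v hθ, Finset.prod_mul_distrib, Finset.prod_ite_eq']
    simp only [Finset.mem_univ, if_true]
    ring
  simp_rw [e]
  rw [integral_const_mul, integral_fintype_prod_volume_eq_prod
    (fun i x => ProbabilityTheory.gaussianPDFReal (u i) θ x * (if i = d then k x else 1))]
  congr 1
  rw [Finset.prod_eq_single_of_mem d (Finset.mem_univ d)]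
  · simp [ProbabilityTheory.integral_gaussianReal_eq_integral_smul hθ.ne']
  · intro i _ hi
    simpa [hi] using ProbabilityTheory.integral_gaussianPDFReal_eq_one (u i) hθ.ne'

theorem integral_sq_gaussianReal (m : ℝ) (θ : NNReal) :
    ∫ x, x ^ 2 ∂ProbabilityTheory.gaussianReal m θ = m ^ 2 + θ := by
  have h := ProbabilityTheory.variance_eq_sub
    (ProbabilityTheory.memLp_id_gaussianReal (μ := m) (v := θ) 2)
  rw [ProbabilityTheory.variance_id_gaussianReal] at h
  simp only [Pi.pow_apply, id, ProbabilityTheory.integral_id_gaussianReal] at h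
  linarith

theorem continuous_maxwellian (ρ : ℝ) (u : Fin 3 → ℝ) (θ : ℝ) :
    Continuous (maxwellian ρ u θ) := by
  unfold maxwellian
  fun_prop

theorem exists_weighted_bound_maxwellian (ρ : ℝ) (u : Fin 3 → ℝ) (θ : ℝ) (n : ℕ) :
    ∃ C, ∀ v, (1 + ‖v‖) ^ n * |maxwellian ρ u θ v| ≤ C := by
  rcases le_or_gt θ 0 with hθ | hθ
  · exact ⟨0, fun v => by simp [maxwellian_of_nonpos ρ u hθ]⟩
  refine ⟨(1 + ‖u‖) ^ n * |ρ * (2 * π * θ) ^ (-(3 : ℝ) / 2)| * Real.exp (n ^ 2 * θ / 2),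
    fun v => ?_⟩
  set c := ρ * (2 * π * θ) ^ (-(3 : ℝ) / 2)
  have h1 : 1 + ‖v‖ ≤ (1 + ‖u‖) * (1 + ‖v - u‖) := by
    have := norm_le_norm_add_norm_sub' v u
    nlinarith [norm_nonneg u, norm_nonneg (v - u)]
  have h2 : ‖v - u‖ ^ 2 ≤ ∑ d, (v d - u d) ^ 2 := by
    rw [← Real.le_sqrt (norm_nonneg _) (by positivity),
      pi_norm_le_iff_of_nonneg (Real.sqrt_nonneg _)]
    exact fun i => Real.abs_le_sqrt (Finset.single_le_sum (f := fun d => (v d - u d) ^ 2)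
      (fun d _ => sq_nonneg _) (Finset.mem_univ i))
  have h3 : Real.exp (-(∑ d, (v d - u d) ^ 2) / (2 * θ)) ≤ Real.exp (-‖v - u‖ ^ 2 / (2 * θ)) := by
    gcongr
  have h4 : (1 + ‖v - u‖) ^ n ≤ Real.exp (n * ‖v - u‖) := by
    rw [Real.exp_nat_mul]
    gcongr
    linarith [Real.add_one_le_exp ‖v - u‖]
  have h5 : n * ‖v - u‖ + -‖v - u‖ ^ 2 / (2 * θ) ≤ n ^ 2 * θ / 2 := by
    have : n ^ 2 * θ / 2 - (n * ‖v - u‖ + -‖v - u‖ ^ 2 / (2 * θ))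
        = (n * θ - ‖v - u‖) ^ 2 / (2 * θ) := by
      field_simp
      ring
    have : 0 ≤ (n * θ - ‖v - u‖) ^ 2 / (2 * θ) := by positivity
    linarith
  calc (1 + ‖v‖) ^ n * |maxwellian ρ u θ v|
      = (1 + ‖v‖) ^ n * (|c| * Real.exp (-(∑ d, (v d - u d) ^ 2) / (2 * θ))) := by
        rw [maxwellian, abs_mul, Real.abs_exp]
    _ ≤ ((1 + ‖u‖) * (1 + ‖v - u‖)) ^ n * (|c| * Real.exp (-‖v - u‖ ^ 2 / (2 * θ))) := by
        gcongr
    _ = (1 + ‖u‖) ^ n * |c| * ((1 + ‖v - u‖) ^ n * Real.exp (-‖v - u‖ ^ 2 / (2 * θ))) := by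
        rw [mul_pow]; ring
    _ ≤ (1 + ‖u‖) ^ n * |c|
        * (Real.exp (n * ‖v - u‖) * Real.exp (-‖v - u‖ ^ 2 / (2 * θ))) := by gcongr
    _ ≤ (1 + ‖u‖) ^ n * |c| * Real.exp (n ^ 2 * θ / 2) := by
        rw [← Real.exp_add]
        gcongr

/-- The mass, momentum and energy of the Maxwellian, for positive thermal velocity. -/
theorem integral_maxwellian (ρ : ℝ) (u : Fin 3 → ℝ) {θ : ℝ} (hθ : 0 < θ) :
    ∫ v, maxwellian ρ u θ v = ρ := by
  lift θ to NNReal using hθ.le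
  simpa using integral_coord_mul_maxwellian ρ u (NNReal.coe_pos.1 hθ) (fun _ => 1) 0

theorem integral_velocity_mul_maxwellian (ρ : ℝ) (u : Fin 3 → ℝ) {θ : ℝ} (hθ : 0 < θ)
    (d : Fin 3) : ∫ v, v d * maxwellian ρ u θ v = ρ * u d := by
  lift θ to NNReal using hθ.le
  simpa using integral_coord_mul_maxwellian ρ u (NNReal.coe_pos.1 hθ) (fun x => x) d

theorem integral_sum_sq_mul_maxwellian (ρ : ℝ) (u : Fin 3 → ℝ) {θ : ℝ} (hθ : 0 < θ) :
    ∫ v, (∑ d, v d ^ 2) * maxwellian ρ u θ v = ρ * (∑ d, u d ^ 2) + 3 * ρ * θ := by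
  obtain ⟨C, hC⟩ := exists_weighted_bound_maxwellian ρ u θ 8
  have hi := integrable_coord_mul_coord_mul (continuous_maxwellian ρ u θ) hC
  lift θ to NNReal using hθ.le
  simp_rw [Finset.sum_mul]
  rw [integral_finsetSum _ fun d _ => by simpa only [sq] using hi d d]
  have := fun d => integral_coord_mul_maxwellian ρ u (NNReal.coe_pos.1 hθ) (fun x => x ^ 2) d
  simp_rw [this, integral_sq_gaussianReal, Fin.sum_univ_three]
  ring

end VelocityMoments

section Balance

theorem pd_eq_fderiv {g : (Fin 3 → ℝ) → ℝ} {x : Fin 3 → ℝ} (hg : DifferentiableAt ℝ g x)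
    (j : Fin 3) : pd j g x = fderiv ℝ g x (Pi.single j 1) := by
  have hx : Function.update x j (x j) = x := Function.update_eq_self j x
  have h : HasFDerivAt g (fderiv ℝ g x) (Function.update x j (x j)) := by
    rw [hx]; exact hg.hasFDerivAt
  exact (h.comp_hasDerivAt (x j) (hasDerivAt_update x j (x j))).deriv

theorem deriv_eq_fderiv_prod {G : ℝ × (Fin 3 → ℝ) → ℝ} {t : ℝ} {x : Fin 3 → ℝ}
    (hG : DifferentiableAt ℝ G (t, x)) :
    deriv (fun s => G (s, x)) t = fderiv ℝ G (t, x) (1, 0) :=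
  (hG.hasFDerivAt.comp_hasDerivAt t ((hasDerivAt_id t).prodMk (hasDerivAt_const t x))).deriv

theorem pd_eq_fderiv_prod {G : ℝ × (Fin 3 → ℝ) → ℝ} {t : ℝ} {x : Fin 3 → ℝ}
    (hG : DifferentiableAt ℝ G (t, x)) (j : Fin 3) :
    pd j (fun y => G (t, y)) x = fderiv ℝ G (t, x) (0, Pi.single j 1) := by
  have h : HasFDerivAt (fun y => G (t, y))
      ((fderiv ℝ G (t, x)).comp (ContinuousLinearMap.inr ℝ ℝ (Fin 3 → ℝ))) x :=
    hG.hasFDerivAt.comp x (hasFDerivAt_prodMk_right t x)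
  rw [pd_eq_fderiv h.differentiableAt, h.fderiv]
  simp

/-- The free-transport derivative `∂f/∂t + v · ∇ₓ f`. -/
noncomputable def transportDeriv (f : ℝ → (Fin 3 → ℝ) → (Fin 3 → ℝ) → ℝ)
    (z : ℝ × (Fin 3 → ℝ)) (v : Fin 3 → ℝ) : ℝ :=
  fderiv ℝ (fun z : ℝ × (Fin 3 → ℝ) => f z.1 z.2 v) z (1, 0)
    + ∑ j, v j * fderiv ℝ (fun z : ℝ × (Fin 3 → ℝ) => f z.1 z.2 v) z (0, Pi.single j 1)

section Kinetic

variable {f : ℝ → (Fin 3 → ℝ) → (Fin 3 → ℝ) → ℝ}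

theorem contDiff_position
    (hC1 : ContDiff ℝ 1 fun w : ℝ × (Fin 3 → ℝ) × (Fin 3 → ℝ) => f w.1 w.2.1 w.2.2)
    (v : Fin 3 → ℝ) :
    ContDiff ℝ 1 fun z : ℝ × (Fin 3 → ℝ) => f z.1 z.2 v :=
  hC1.comp (contDiff_fst.prodMk (contDiff_snd.prodMk contDiff_const))

theorem contDiff_velocity
    (hC1 : ContDiff ℝ 1 fun w : ℝ × (Fin 3 → ℝ) × (Fin 3 → ℝ) => f w.1 w.2.1 w.2.2)
    (t : ℝ) (x : Fin 3 → ℝ) : ContDiff ℝ 1 (f t x) :=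
  hC1.comp (contDiff_const.prodMk (contDiff_const.prodMk contDiff_id))

theorem continuous_fderiv_position
    (hC1 : ContDiff ℝ 1 fun w : ℝ × (Fin 3 → ℝ) × (Fin 3 → ℝ) => f w.1 w.2.1 w.2.2)
    (e : ℝ × (Fin 3 → ℝ)) :
    Continuous fun q : (ℝ × (Fin 3 → ℝ)) × (Fin 3 → ℝ) =>
      fderiv ℝ (fun z : ℝ × (Fin 3 → ℝ) => f z.1 z.2 q.2) q.1 e := by
  have h : ∀ q : (ℝ × (Fin 3 → ℝ)) × (Fin 3 → ℝ),
      fderiv ℝ (fun z : ℝ × (Fin 3 → ℝ) => f z.1 z.2 q.2) q.1 e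
        = fderiv ℝ (fun w : ℝ × (Fin 3 → ℝ) × (Fin 3 → ℝ) => f w.1 w.2.1 w.2.2)
          (q.1.1, q.1.2, q.2) (e.1, e.2, 0) := by
    intro q
    have hl : HasFDerivAt (fun z : ℝ × (Fin 3 → ℝ) => (z.1, z.2, q.2))
        ((ContinuousLinearMap.fst ℝ ℝ (Fin 3 → ℝ)).prod
          ((ContinuousLinearMap.snd ℝ ℝ (Fin 3 → ℝ)).prod 0)) q.1 :=
      hasFDerivAt_fst.prodMk (hasFDerivAt_snd.prodMk (hasFDerivAt_const q.2 q.1))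
    have := ((hC1.differentiable one_ne_zero)
      (q.1.1, q.1.2, q.2)).hasFDerivAt.comp q.1 hl
    rw [show (fun z : ℝ × (Fin 3 → ℝ) => f z.1 z.2 q.2)
      = (fun w : ℝ × (Fin 3 → ℝ) × (Fin 3 → ℝ) => f w.1 w.2.1 w.2.2) ∘
        fun z : ℝ × (Fin 3 → ℝ) => (z.1, z.2, q.2) from rfl, this.fderiv]
    simp
  simp_rw [h]
  exact ((hC1.continuous_fderiv one_ne_zero).comp (by fun_prop)).clm_apply continuous_const

theorem continuous_transportDeriv
    (hC1 : ContDiff ℝ 1 fun w : ℝ × (Fin 3 → ℝ) × (Fin 3 → ℝ) => f w.1 w.2.1 w.2.2) :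
    Continuous (Function.uncurry (transportDeriv f)) :=
  (continuous_fderiv_position hC1 _).add (continuous_finsetSum _ fun j _ =>
    ((continuous_apply j).comp continuous_snd).mul (continuous_fderiv_position hC1 _))

theorem fderiv_moment_add_sum_fderiv_flux
    (hC1 : ContDiff ℝ 1 fun w : ℝ × (Fin 3 → ℝ) × (Fin 3 → ℝ) => f w.1 w.2.1 w.2.2)
    {φ : (Fin 3 → ℝ) → ℝ} (hφ : Continuous φ)
    (hφ3 : ∀ v, |φ v| ≤ 3 * (1 + ‖v‖) ^ 2) {U : Set (ℝ × (Fin 3 → ℝ))} (hU : IsOpen U) {C : ℝ}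
    (hC : ∀ z ∈ U, ∀ v, (1 + ‖v‖) ^ 8 * (|f z.1 z.2 v| + |transportDeriv f z v|) ≤ C)
    (hm : ContDiff ℝ 1 fun z : ℝ × (Fin 3 → ℝ) => ∫ v, φ v * f z.1 z.2 v)
    (hflux : ∀ j, ContDiff ℝ 1 fun z : ℝ × (Fin 3 → ℝ) => ∫ v, v j * (φ v * f z.1 z.2 v))
    {z : ℝ × (Fin 3 → ℝ)} (hz : z ∈ U) :
    fderiv ℝ (fun z : ℝ × (Fin 3 → ℝ) => ∫ v, φ v * f z.1 z.2 v) z (1, 0)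
      + ∑ j, fderiv ℝ (fun z : ℝ × (Fin 3 → ℝ) => ∫ v, v j * (φ v * f z.1 z.2 v)) z
          (0, Pi.single j 1)
      = ∫ v, φ v * transportDeriv f z v := by
  let e : Option (Fin 3) → ℝ × (Fin 3 → ℝ) := fun o => o.elim (1, 0) fun j => (0, Pi.single j 1)
  let w : Option (Fin 3) → (Fin 3 → ℝ) → ℝ := fun o v => o.elim 1 fun j => v j
  have hfd : ∀ (z : ℝ × (Fin 3 → ℝ)) v,
      fderiv ℝ (fun z : ℝ × (Fin 3 → ℝ) => φ v * f z.1 z.2 v) z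
        = φ v • fderiv ℝ (fun z : ℝ × (Fin 3 → ℝ) => f z.1 z.2 v) z := fun z v =>
    fderiv_const_mul ((contDiff_position hC1 v).differentiable one_ne_zero z) _
  have hw : ∀ i, Continuous (w i) := by
    rintro (_ | j)
    · exact continuous_const
    · exact continuous_apply j
  have hw1 : ∀ i v, |w i v| ≤ 1 + ‖v‖ := by
    rintro (_ | j) v
    · simp [w]
    · exact abs_apply_le_one_add_norm v j
  have hsum : ∀ (z : ℝ × (Fin 3 → ℝ)) v,
      ∑ i, w i v * fderiv ℝ (fun z : ℝ × (Fin 3 → ℝ) => φ v * f z.1 z.2 v) z (e i)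
        = φ v * transportDeriv f z v := by
    intro z v
    simp_rw [hfd, Fintype.sum_option, transportDeriv, mul_add, Finset.mul_sum]
    simp [e, w, mul_left_comm]
  have hm' : ∀ i, ContDiff ℝ 1 fun z : ℝ × (Fin 3 → ℝ) => ∫ v, w i v * (φ v * f z.1 z.2 v) := by
    rintro (_ | j)
    · simpa [w] using hm
    · exact hflux j
  have hfc : Continuous fun q : (ℝ × (Fin 3 → ℝ)) × (Fin 3 → ℝ) => f q.1.1 q.1.2 q.2 :=
    hC1.continuous.comp (f := fun q : (ℝ × (Fin 3 → ℝ)) × (Fin 3 → ℝ) => (q.1.1, q.1.2, q.2))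
      (by fun_prop)
  have key := sum_fderiv_integral_eq_integral_sum_fderiv (κ := volume) (e := e) (w := w)
    (g := fun (z : ℝ × (Fin 3 → ℝ)) v => φ v * f z.1 z.2 v)
    (b := fun v => 3 * C * ((1 + ‖v‖) ^ 5)⁻¹) hU hw
    ((hφ.comp continuous_snd).mul hfc)
    (fun v => contDiff_const.mul (contDiff_position hC1 v))
    (fun i => by
      simp only [hfd, smul_apply, smul_eq_mul]
      exact (hφ.comp continuous_snd).mul (continuous_fderiv_position hC1 (e i)))
    (integrable_inv_one_add_norm_pow_five.const_mul _)
    (fun z hz v i => by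
      rw [← mul_assoc]
      refine abs_mul_le_of_weighted_bound (by positivity) zero_le_three ?_
        (le_trans ?_ (hC z hz v))
      · rw [abs_mul]
        calc |w i v| * |φ v| ≤ (1 + ‖v‖) * (3 * (1 + ‖v‖) ^ 2) := by
              gcongr
              exacts [hw1 i v, hφ3 v]
          _ = 3 * (1 + ‖v‖) ^ 3 := by ring
      · gcongr
        exact le_add_of_nonneg_right (abs_nonneg _))
    (fun z hz v => by
      rw [hsum]
      refine abs_mul_le_of_weighted_bound (by positivity) zero_le_three ((hφ3 v).trans ?_)
        (le_trans ?_ (hC z hz v))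
      · gcongr <;> simp
      · gcongr
        exact le_add_of_nonneg_left (abs_nonneg _))
    hm' hz
  simp_rw [hsum] at key
  rw [← key, Fintype.sum_option]
  simp [e, w]

end Kinetic

theorem dense_setOf_locally_bddAbove {X Y : Type*} [TopologicalSpace X] [BaireSpace X]
    {k : X → Y → ℝ} (hk : ∀ y, Continuous fun z => k z y) (hb : ∀ z, ∃ C, ∀ y, k z y ≤ C) :
    Dense {z | ∃ U, IsOpen U ∧ z ∈ U ∧ ∃ C, ∀ z' ∈ U, ∀ y, k z' y ≤ C} := by
  have hd := dense_iUnion_interior_of_closed (f := fun n : ℕ => {z | ∀ y, k z y ≤ n})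
    (fun n => by
      simp only [Set.ofPred_forall]
      exact isClosed_iInter fun y => isClosed_le (hk y) continuous_const)
    (Set.eq_univ_of_forall fun z => by
      obtain ⟨C, hC⟩ := hb z
      obtain ⟨n, hn⟩ := exists_nat_ge C
      exact Set.mem_iUnion.2 ⟨n, fun y => (hC y).trans hn⟩)
  refine hd.mono fun z hz => ?_
  obtain ⟨n, hn⟩ := Set.mem_iUnion.1 hz
  exact ⟨_, isOpen_interior, hn, n, fun z' hz' => interior_subset hz'⟩

/-- The conservation laws for mass, momentum and energy, with a linear loss rate `c` and a force
`F`, imply the balance law for the thermal velocity. -/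
theorem thermal_balance_of_conservation_laws {E : Type*} [NormedAddCommGroup E] [NormedSpace ℝ E]
    {ρ θ : E → ℝ} {u q : Fin 3 → E → ℝ} {p : Fin 3 → Fin 3 → E → ℝ} {z e₀ : E} {e : Fin 3 → E}
    {c : ℝ} {F : Fin 3 → ℝ} (hρ : DifferentiableAt ℝ ρ z) (hθ : DifferentiableAt ℝ θ z)
    (hu : ∀ d, DifferentiableAt ℝ (u d) z) (hq : ∀ d, DifferentiableAt ℝ (q d) z)
    (hp : ∀ i j, DifferentiableAt ℝ (p i j) z) (hsymm : ∀ i j, p i j = p j i)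
    (mass : fderiv ℝ ρ z e₀ + ∑ j, fderiv ℝ (fun z => ρ z * u j z) z (e j) = -c * ρ z)
    (momentum : ∀ d, fderiv ℝ (fun z => ρ z * u d z) z e₀
      + ∑ j, fderiv ℝ (fun z => p d j z + ρ z * u d z * u j z) z (e j)
        = -c * (ρ z * u d z) + ρ z * F d)
    (energy : fderiv ℝ (fun z => ρ z * (∑ d, u d z ^ 2) + 3 * ρ z * θ z) z e₀
      + ∑ j, fderiv ℝ (fun z => 2 * q j z + 2 * (∑ d, u d z * p d j z)
          + u j z * (ρ z * (∑ d, u d z ^ 2) + 3 * ρ z * θ z)) z (e j)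
        = -c * (ρ z * (∑ d, u d z ^ 2) + 3 * ρ z * θ z) + 2 * ρ z * ∑ d, F d * u d z) :
    ρ z * (fderiv ℝ θ z e₀ + ∑ j, u j z * fderiv ℝ θ z (e j))
      + (2 / 3) * ∑ j, (fderiv ℝ (q j) z (e j) + ∑ d, p j d z * fderiv ℝ (u d) z (e j)) = 0 := by
  have hm : ∀ d, HasFDerivAt (fun z => ρ z * u d z) _ z := fun d =>
    hρ.hasFDerivAt.mul (hu d).hasFDerivAt
  have hP : ∀ d j, HasFDerivAt (fun z => p d j z + ρ z * u d z * u j z) _ z := fun d j =>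
    (hp d j).hasFDerivAt.add ((hm d).mul (hu j).hasFDerivAt)
  have hE : HasFDerivAt (fun z => ρ z * (∑ d, u d z ^ 2) + 3 * ρ z * θ z) _ z :=
    (hρ.hasFDerivAt.mul (HasFDerivAt.fun_sum fun d _ => (hu d).hasFDerivAt.pow 2)).add
      ((hρ.hasFDerivAt.const_mul 3).mul hθ.hasFDerivAt)
  have hQ : ∀ j, HasFDerivAt (fun z => 2 * q j z + 2 * (∑ d, u d z * p d j z)
      + u j z * (ρ z * (∑ d, u d z ^ 2) + 3 * ρ z * θ z)) _ z := fun j =>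
    (((hq j).hasFDerivAt.const_mul 2).add ((HasFDerivAt.fun_sum fun d _ =>
      (hu d).hasFDerivAt.mul (hp d j).hasFDerivAt).const_mul 2)).add ((hu j).hasFDerivAt.mul hE)
  simp only [(hm _).fderiv] at mass
  simp only [(hm _).fderiv, (hP _ _).fderiv] at momentum
  rw [hE.fderiv] at energy
  simp only [(hQ _).fderiv] at energy
  have m0 := momentum 0
  have m1 := momentum 1
  have m2 := momentum 2
  simp [Fin.sum_univ_three] at mass m0 m1 m2 energy ⊢
  rw [hsymm 1 0, hsymm 2 0, hsymm 2 1] at *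
  linear_combination (1 / 3) * (energy - 2 * (u 0 z * m0 + u 1 z * m1 + u 2 z * m2)
    + (u 0 z ^ 2 + u 1 z ^ 2 + u 2 z ^ 2 - 3 * θ z) * mass)

end Balance

section KineticEquation

theorem abs_pd_le_norm_fderiv {g : (Fin 3 → ℝ) → ℝ} {x : Fin 3 → ℝ}
    (hg : DifferentiableAt ℝ g x) (j : Fin 3) : |pd j g x| ≤ ‖fderiv ℝ g x‖ := by
  rw [pd_eq_fderiv hg]
  simpa [Pi.norm_single] using (fderiv ℝ g x).le_opNorm (Pi.single j 1)

theorem continuous_pd {g : (Fin 3 → ℝ) → ℝ} (hg : ContDiff ℝ 1 g) (j : Fin 3) :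
    Continuous (pd j g) := by
  have h : pd j g = fun x => fderiv ℝ g x (Pi.single j 1) :=
    funext fun x => pd_eq_fderiv (hg.differentiable one_ne_zero x) j
  rw [h]
  exact (hg.continuous_fderiv one_ne_zero).clm_apply continuous_const

/-- The relaxation-minus-acceleration side `ν (M - h) - G · ∇ᵥ h` of the kinetic equation. -/
noncomputable def kineticSource (ν : ℝ) (M h : (Fin 3 → ℝ) → ℝ) (G : Fin 3 → ℝ)
    (v : Fin 3 → ℝ) : ℝ :=
  ν * (M v - h v) - ∑ j, G j * pd j h v

variable {ν : ℝ} {M h : (Fin 3 → ℝ) → ℝ} {G : Fin 3 → ℝ} {C₁ C₂ : ℝ}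

theorem exists_weighted_bound_kineticSource (hh : Differentiable ℝ h)
    (hM : ∀ v, (1 + ‖v‖) ^ 8 * |M v| ≤ C₁)
    (hC : ∀ v, (1 + ‖v‖) ^ 8 * (|h v| + ‖fderiv ℝ h v‖) ≤ C₂) :
    ∃ C, ∀ v, (1 + ‖v‖) ^ 8 * (|h v| + |kineticSource ν M h G v|) ≤ C := by
  refine ⟨|ν| * C₁ + (1 + |ν| + ∑ j, |G j|) * C₂, fun v => ?_⟩
  have hS : |kineticSource ν M h G v|
      ≤ |ν| * (|M v| + |h v|) + (∑ j, |G j|) * ‖fderiv ℝ h v‖ := by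
    refine (abs_sub _ _).trans (add_le_add ?_ ?_)
    · rw [abs_mul]
      gcongr
      exact abs_sub _ _
    · rw [Finset.sum_mul]
      refine (Finset.abs_sum_le_sum_abs _ _).trans (Finset.sum_le_sum fun j _ => ?_)
      rw [abs_mul]
      gcongr
      exact abs_pd_le_norm_fderiv (hh v) j
  have hG : 0 ≤ ∑ j, |G j| := by positivity
  calc (1 + ‖v‖) ^ 8 * (|h v| + |kineticSource ν M h G v|)
      ≤ (1 + ‖v‖) ^ 8 * (|ν| * |M v|
          + (1 + |ν| + ∑ j, |G j|) * (|h v| + ‖fderiv ℝ h v‖)) := by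
        refine mul_le_mul_of_nonneg_left ?_ (by positivity)
        nlinarith [abs_nonneg (h v), norm_nonneg (fderiv ℝ h v),
          mul_nonneg hG (abs_nonneg (h v)), mul_nonneg (abs_nonneg ν) (norm_nonneg (fderiv ℝ h v))]
    _ = |ν| * ((1 + ‖v‖) ^ 8 * |M v|) + (1 + |ν| + ∑ j, |G j|)
          * ((1 + ‖v‖) ^ 8 * (|h v| + ‖fderiv ℝ h v‖)) := by ring
    _ ≤ _ := by
        gcongr
        exacts [hM v, hC v]

theorem integral_mul_kineticSource {φ : (Fin 3 → ℝ) → ℝ} (hφ : Continuous φ)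
    (hφ3 : ∀ v, |φ v| ≤ 3 * (1 + ‖v‖) ^ 2) (hh : ContDiff ℝ 1 h) (hMc : Continuous M)
    (hM : ∀ v, (1 + ‖v‖) ^ 8 * |M v| ≤ C₁)
    (hC : ∀ v, (1 + ‖v‖) ^ 8 * (|h v| + ‖fderiv ℝ h v‖) ≤ C₂) :
    ∫ v, φ v * kineticSource ν M h G v
      = ν * ((∫ v, φ v * M v) - ∫ v, φ v * h v) - ∑ j, G j * ∫ v, φ v * pd j h v := by
  have iM := integrable_mul_of_quadratic_bound hMc hM hφ hφ3
  have ih := integrable_mul_of_quadratic_bound hh.continuous (C := C₂) (fun v =>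
    le_trans (by gcongr; simp) (hC v)) hφ hφ3
  have ip := fun j => integrable_mul_of_quadratic_bound (continuous_pd hh j) (C := C₂) (fun v =>
    le_trans (mul_le_mul_of_nonneg_left (le_add_of_nonneg_of_le (abs_nonneg _)
      (abs_pd_le_norm_fderiv (hh.differentiable one_ne_zero v) j)) (by positivity)) (hC v)) hφ hφ3
  have iS : Integrable fun v => ∑ j, G j * (φ v * pd j h v) :=
    integrable_finsetSum _ fun j _ => (ip j).const_mul (G j)
  have iD : Integrable fun v => φ v * M v - φ v * h v := iM.sub ih
  have e : (fun v => φ v * kineticSource ν M h G v)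
      = fun v => ν * (φ v * M v - φ v * h v) - ∑ j, G j * (φ v * pd j h v) := by
    ext v
    simp only [kineticSource, mul_sub, Finset.mul_sum]
    simp only [mul_left_comm]
  rw [e, integral_sub (iD.const_mul ν) iS, integral_const_mul, integral_sub iM ih,
    integral_finsetSum _ fun j _ => (ip j).const_mul _]
  simp_rw [integral_const_mul]

/-- The moments of the source of the BGK equation: the collisions conserve mass, momentum and
energy when `0 < θ`, and the Maxwellian vanishes otherwise. -/
theorem exists_moments_kineticSource {r θ : ℝ} {w : Fin 3 → ℝ} (hh : ContDiff ℝ 1 h)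
    (hC : ∀ v, (1 + ‖v‖) ^ 8 * (|h v| + ‖fderiv ℝ h v‖) ≤ C₂)
    (hr : r = ∫ v, h v) (hw : ∀ d, r * w d = ∫ v, v d * h v)
    (hθ : r * (∑ d, w d ^ 2) + 3 * r * θ = ∫ v, (∑ d, v d ^ 2) * h v)
    (h0 : ∀ j, (∫ v, pd j h v) = 0)
    (h1 : ∀ d j, (∫ v, v d * pd j h v) = -(if d = j then r else 0))
    (h2 : ∀ j, (∫ v, (∑ d, v d ^ 2) * pd j h v) = -2 * r * w j) :
    ∃ c, (∫ v, 1 * kineticSource ν (maxwellian r w θ) h G v) = -c * r ∧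
      (∀ d, (∫ v, v d * kineticSource ν (maxwellian r w θ) h G v)
        = -c * (r * w d) + r * G d) ∧
      (∫ v, (∑ d, v d ^ 2) * kineticSource ν (maxwellian r w θ) h G v)
        = -c * (r * (∑ d, w d ^ 2) + 3 * r * θ) + 2 * r * ∑ d, G d * w d := by
  obtain ⟨C₁, hM⟩ := exists_weighted_bound_maxwellian r w θ 8
  have hMc := continuous_maxwellian r w θ
  have k := fun (φ : (Fin 3 → ℝ) → ℝ) hφ hφ3 =>
    integral_mul_kineticSource (ν := ν) (G := G) (φ := φ) hφ hφ3 hh hMc hM hC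
  rw [k _ continuous_const abs_one_le_quadratic, k _ (by fun_prop) sum_sq_le]
  simp_rw [fun d : Fin 3 => k (fun v => v d) (continuous_apply d) (abs_apply_le_quadratic d),
    one_mul, h0, h1, h2, ← hr, ← hw, ← hθ]
  rcases le_or_gt θ 0 with hθ0 | hθ0
  · refine ⟨ν, ?_, fun d => ?_, ?_⟩ <;>
      simp [maxwellian_of_nonpos r w hθ0, Fin.sum_univ_three] <;> ring
  · refine ⟨0, ?_, fun d => ?_, ?_⟩
    · simp [integral_maxwellian r w hθ0]
    · simp [integral_velocity_mul_maxwellian r w hθ0]; ring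
    · rw [integral_sum_sq_mul_maxwellian r w hθ0]; simp [Fin.sum_univ_three]; ring

end KineticEquation

/-- The thermal-velocity (energy) balance
`ρ (∂u_th/∂t + ∑_j u_j ∂u_th/∂x_j) + (2/3) ∑_j (∂q_j/∂x_j + ∑_d p_{jd} ∂u_d/∂x_j) = 0`
for C¹ solutions of the Vlasov–Poisson–BGK equation. -/
theorem thermal_velocity_balance
    (f : ℝ → (Fin 3 → ℝ) → (Fin 3 → ℝ) → ℝ)
    (F : ℝ → (Fin 3 → ℝ) → Fin 3 → ℝ)
    (ν : ℝ) (hν : 0 ≤ ν)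
    (ρ : ℝ → (Fin 3 → ℝ) → ℝ)
    (u : ℝ → (Fin 3 → ℝ) → Fin 3 → ℝ)
    (uth : ℝ → (Fin 3 → ℝ) → ℝ)
    (p : ℝ → (Fin 3 → ℝ) → Fin 3 → Fin 3 → ℝ)
    (q : ℝ → (Fin 3 → ℝ) → Fin 3 → ℝ)
    -- `f` is C¹
    (hC1 : ContDiff ℝ 1 fun w : ℝ × (Fin 3 → ℝ) × (Fin 3 → ℝ) => f w.1 w.2.1 w.2.2)
    -- positivity of the density
    (hρpos : ∀ t x, 0 < ρ t x)
    -- `ρ, u, uth` are the density, macroscopic velocity and thermal velocity of `f(t,x,·)`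
    (hρ : ∀ t x, ρ t x = ∫ v, f t x v)
    (hu : ∀ t x d, ρ t x * u t x d = ∫ v, v d * f t x v)
    (huth : ∀ t x, ρ t x * (∑ d, u t x d ^ 2) + 3 * ρ t x * uth t x
      = ∫ v, (∑ d, v d ^ 2) * f t x v)
    -- the pressure tensor and the heat flux
    (hp : ∀ t x i j, p t x i j = ∫ v, (v i - u t x i) * (v j - u t x j) * f t x v)
    (hq : ∀ t x j, q t x j
      = (1 / 2) * ∫ v, (∑ d, (v d - u t x d) ^ 2) * (v j - u t x j) * f t x v)
    -- `ρ`, `u`, `uth`, `p` and `q` are C¹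
    (hρC1 : ContDiff ℝ 1 fun w : ℝ × (Fin 3 → ℝ) => ρ w.1 w.2)
    (huC1 : ∀ d : Fin 3, ContDiff ℝ 1 fun w : ℝ × (Fin 3 → ℝ) => u w.1 w.2 d)
    (huthC1 : ContDiff ℝ 1 fun w : ℝ × (Fin 3 → ℝ) => uth w.1 w.2)
    (hpC1 : ∀ i j : Fin 3, ContDiff ℝ 1 fun w : ℝ × (Fin 3 → ℝ) => p w.1 w.2 i j)
    (hqC1 : ∀ j : Fin 3, ContDiff ℝ 1 fun w : ℝ × (Fin 3 → ℝ) => q w.1 w.2 j)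
    -- the Vlasov–Poisson–BGK equation
    (hpde : ∀ t x v,
      deriv (fun s => f s x v) t
        + (∑ j, v j * pd j (fun y => f t y v) x)
        + (∑ j, F t x j * pd j (fun w => f t x w) v)
      = ν * (maxwellian (ρ t x) (u t x) (uth t x) v - f t x v))
    -- `f(t,x,·)` and its derivatives decay rapidly in `v`
    (hdecay : ∀ t x (n : ℕ), ∃ C : ℝ, ∀ v,
      (1 + ‖v‖) ^ n * (|f t x v| + ‖fderiv ℝ (f t x) v‖) ≤ C)
    -- differentiation under the velocity integral is valid
    (hDUIt0 : ∀ t x, HasDerivAt (fun s => ∫ v, f s x v)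
      (∫ v, deriv (fun s => f s x v) t) t)
    (hDUIt1 : ∀ t x (d : Fin 3), HasDerivAt (fun s => ∫ v, v d * f s x v)
      (∫ v, v d * deriv (fun s => f s x v) t) t)
    (hDUIt2 : ∀ t x, HasDerivAt (fun s => ∫ v, (∑ d, v d ^ 2) * f s x v)
      (∫ v, (∑ d, v d ^ 2) * deriv (fun s => f s x v) t) t)
    (hDUIx0 : ∀ t x (j : Fin 3),
      HasDerivAt (fun s => ∫ v, v j * f t (Function.update x j s) v)
        (∫ v, v j * pd j (fun y => f t y v) x) (x j))
    (hDUIx1 : ∀ t x (d j : Fin 3),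
      HasDerivAt (fun s => ∫ v, v d * v j * f t (Function.update x j s) v)
        (∫ v, v d * v j * pd j (fun y => f t y v) x) (x j))
    (hDUIx2 : ∀ t x (j : Fin 3),
      HasDerivAt (fun s => ∫ v, (∑ d, v d ^ 2) * v j * f t (Function.update x j s) v)
        (∫ v, (∑ d, v d ^ 2) * v j * pd j (fun y => f t y v) x) (x j))
    -- velocity boundary terms vanish (integration by parts in `v`)
    (hIBP0 : ∀ t x (j : Fin 3), (∫ v, pd j (fun w => f t x w) v) = 0)
    (hIBP1 : ∀ t x (d j : Fin 3), (∫ v, v d * pd j (fun w => f t x w) v)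
      = -(if d = j then ρ t x else 0))
    (hIBP2 : ∀ t x (j : Fin 3), (∫ v, (∑ d, v d ^ 2) * pd j (fun w => f t x w) v)
      = -2 * ρ t x * u t x j) :
    ∀ t x,
      ρ t x * (deriv (fun s => uth s x) t
          + ∑ j, u t x j * pd j (fun y => uth t y) x)
        + (2 / 3) * ∑ j : Fin 3, (pd j (fun y => q t y j) x
          + ∑ d, p t x j d * pd j (fun y => u t y d) x) = 0 := by
  have hf : ∀ z : ℝ × (Fin 3 → ℝ), ContDiff ℝ 1 (f z.1 z.2) := fun z =>
    contDiff_velocity hC1 z.1 z.2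
  have hb : ∀ z : ℝ × (Fin 3 → ℝ), ∃ C, ∀ v, (1 + ‖v‖) ^ 8 * |f z.1 z.2 v| ≤ C := fun z => by
    obtain ⟨C, hC⟩ := hdecay z.1 z.2 8
    exact ⟨C, fun v => le_trans (by gcongr; simp) (hC v)⟩
  have hsource : ∀ (z : ℝ × (Fin 3 → ℝ)) v, transportDeriv f z v = kineticSource ν
      (maxwellian (ρ z.1 z.2) (u z.1 z.2) (uth z.1 z.2)) (f z.1 z.2) (F z.1 z.2) v := by
    rintro ⟨t, x⟩ v
    have hd := (contDiff_position hC1 v).differentiable one_ne_zero (t, x)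
    rw [transportDeriv, ← deriv_eq_fderiv_prod hd]
    simp_rw [← pd_eq_fderiv_prod hd]
    exact eq_sub_of_add_eq (hpde t x v)
  have hdense : Dense {z : ℝ × (Fin 3 → ℝ) | ∃ U, IsOpen U ∧ z ∈ U ∧ ∃ C, ∀ z' ∈ U, ∀ v,
      (1 + ‖v‖) ^ 8 * (|f z'.1 z'.2 v| + |transportDeriv f z' v|) ≤ C} := by
    refine dense_setOf_locally_bddAbove (fun v => ?_) fun z => ?_
    · exact continuous_const.mul ((contDiff_position hC1 v).continuous.abs.add
        ((continuous_transportDeriv hC1).comp (Continuous.prodMk_left v)).abs)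
    · obtain ⟨C₁, hC₁⟩ := exists_weighted_bound_maxwellian
        (ρ z.1 z.2) (u z.1 z.2) (uth z.1 z.2) 8
      obtain ⟨C₂, hC₂⟩ := hdecay z.1 z.2 8
      simp_rw [hsource]
      exact exists_weighted_bound_kineticSource ((hf z).differentiable one_ne_zero) hC₁ hC₂
  have hmass : (fun z : ℝ × (Fin 3 → ℝ) => ∫ v, 1 * f z.1 z.2 v) = fun z => ρ z.1 z.2 := by
    simp_rw [one_mul, ← hρ]
  have hmom : ∀ d, (fun z : ℝ × (Fin 3 → ℝ) => ∫ v, v d * f z.1 z.2 v)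
      = fun z => ρ z.1 z.2 * u z.1 z.2 d := by
    simp_rw [← hu, implies_true]
  have hen : (fun z : ℝ × (Fin 3 → ℝ) => ∫ v, (∑ d, v d ^ 2) * f z.1 z.2 v) = fun z =>
      ρ z.1 z.2 * (∑ d, u z.1 z.2 d ^ 2) + 3 * ρ z.1 z.2 * uth z.1 z.2 := by
    simp_rw [← huth]
  have hmassflux : ∀ j, (fun z : ℝ × (Fin 3 → ℝ) => ∫ v, v j * (1 * f z.1 z.2 v))
      = fun z => ρ z.1 z.2 * u z.1 z.2 j := by
    simp_rw [one_mul, ← hu, implies_true]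
  have hmomflux : ∀ d j, (fun z : ℝ × (Fin 3 → ℝ) => ∫ v, v j * (v d * f z.1 z.2 v))
      = fun z => p z.1 z.2 d j + ρ z.1 z.2 * u z.1 z.2 d * u z.1 z.2 j := by
    intro d j
    ext z
    obtain ⟨C, hC⟩ := hb z
    rw [hp, ← integral_coord_mul_coord_mul (hf z).continuous hC (hρ _ _) (hu _ _)]
    simp_rw [← mul_assoc, mul_comm]
  have henflux : ∀ j, (fun z : ℝ × (Fin 3 → ℝ) => ∫ v, v j * ((∑ d, v d ^ 2) * f z.1 z.2 v))
      = fun z => 2 * q z.1 z.2 j + 2 * (∑ d, u z.1 z.2 d * p z.1 z.2 d j)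
        + u z.1 z.2 j
          * (ρ z.1 z.2 * (∑ d, u z.1 z.2 d ^ 2) + 3 * ρ z.1 z.2 * uth z.1 z.2) := by
    intro j
    ext z
    obtain ⟨C, hC⟩ := hb z
    rw [hq, ← mul_assoc, mul_one_div_cancel two_ne_zero, one_mul, huth]
    simp_rw [hp]
    rw [← integral_sum_sq_mul_coord_mul (hf z).continuous hC (hρ _ _) (hu _ _)]
    simp_rw [← mul_assoc, mul_comm]
  have hsymm : ∀ t x i j, p t x i j = p t x j i := fun t x i j => by
    rw [hp, hp]
    simp_rw [mul_comm (_ - u t x i)]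
  have hbalance : ∀ z : ℝ × (Fin 3 → ℝ),
      ρ z.1 z.2 * (fderiv ℝ (fun z : ℝ × (Fin 3 → ℝ) => uth z.1 z.2) z (1, 0)
      + ∑ j, u z.1 z.2 j * fderiv ℝ (fun z : ℝ × (Fin 3 → ℝ) => uth z.1 z.2) z (0, Pi.single j 1))
      + (2 / 3) * ∑ j, (fderiv ℝ (fun z : ℝ × (Fin 3 → ℝ) => q z.1 z.2 j) z (0, Pi.single j 1)
        + ∑ d, p z.1 z.2 j d
          * fderiv ℝ (fun z : ℝ × (Fin 3 → ℝ) => u z.1 z.2 d) z (0, Pi.single j 1)) = 0 := by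
    refine congr_fun (Continuous.ext_on hdense (g := fun _ => (0 : ℝ)) ?_ continuous_const ?_)
    · have h1 := huthC1.continuous_fderiv one_ne_zero
      have h2 := fun d => (huC1 d).continuous_fderiv one_ne_zero
      have h3 := fun d => (hqC1 d).continuous_fderiv one_ne_zero
      have h4 := fun d => (huC1 d).continuous
      have h5 := fun i j => (hpC1 i j).continuous
      have h6 := hρC1.continuous
      fun_prop
    · rintro z ⟨U, hU, hz, C, hC⟩
      obtain ⟨C₂, hC₂⟩ := hdecay z.1 z.2 8
      obtain ⟨c, mass, momentum, energy⟩ := exists_moments_kineticSource (ν := ν)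
        (G := F z.1 z.2) (hf z) hC₂ (hρ _ _) (hu _ _) (huth _ _) (hIBP0 _ _) (hIBP1 _ _)
        (hIBP2 _ _)
      simp_rw [← hsource] at mass momentum energy
      refine thermal_balance_of_conservation_laws (c := c) (F := F z.1 z.2)
        (ρ := fun z : ℝ × (Fin 3 → ℝ) => ρ z.1 z.2) (θ := fun z : ℝ × (Fin 3 → ℝ) => uth z.1 z.2)
        (u := fun d (z : ℝ × (Fin 3 → ℝ)) => u z.1 z.2 d)
        (q := fun d (z : ℝ × (Fin 3 → ℝ)) => q z.1 z.2 d)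
        (p := fun i j (z : ℝ × (Fin 3 → ℝ)) => p z.1 z.2 i j) (e := fun j => (0, Pi.single j 1))
        (hρC1.differentiable one_ne_zero z) (huthC1.differentiable one_ne_zero z)
        (fun d => (huC1 d).differentiable one_ne_zero z)
        (fun d => (hqC1 d).differentiable one_ne_zero z)
        (fun i j => (hpC1 i j).differentiable one_ne_zero z)
        (fun i j => funext fun z => hsymm _ _ i j) ?_ (fun d => ?_) ?_
      · rw [← mass, ← fderiv_moment_add_sum_fderiv_flux hC1 continuous_const
          abs_one_le_quadratic hU hC (by rw [hmass]; fun_prop)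
          (fun j => by rw [hmassflux]; fun_prop) hz, hmass]
        simp_rw [hmassflux]
      · rw [← momentum, ← fderiv_moment_add_sum_fderiv_flux hC1 (continuous_apply d)
          (abs_apply_le_quadratic d) hU hC (by rw [hmom]; fun_prop)
          (fun j => by rw [hmomflux]; fun_prop) hz, hmom]
        simp_rw [hmomflux]
      · rw [← energy, ← fderiv_moment_add_sum_fderiv_flux hC1 (by fun_prop) sum_sq_le hU hC
          (by rw [hen]; fun_prop) (fun j => by rw [henflux]; fun_prop) hz, hen]
        simp_rw [henflux]
  intro t x
  rw [deriv_eq_fderiv_prod (huthC1.differentiable one_ne_zero (t, x))]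
  simp_rw [pd_eq_fderiv_prod (huthC1.differentiable one_ne_zero (t, x)),
    fun d => pd_eq_fderiv_prod ((huC1 d).differentiable one_ne_zero (t, x)),
    fun d => pd_eq_fderiv_prod ((hqC1 d).differentiable one_ne_zero (t, x))]
  exact hbalance (t, x)
end

section
/- Let N ≥ 1 and let ψ₀, ψ₁, …, ψ_{N+1} ∈ ℝ satisfy the periodicity conditions ψ₀ = ψ_N and ψ_{N+1} = ψ₁. Then Σ_{j=1}^{N} (ψ_{j+1} − 2ψ_j + ψ_{j−1})(ψ_{j+1} − ψ_{j−1}) = 0. Consequently, if the discrete density and force are defined by ρ_j = −(ε₀/q) (ψ_{j+1} − 2ψ_j + ψ_{j−1})/Δx² and F_j = −(q/m) (ψ_{j+1} − ψ_{j−1})/(2Δx) for constants q, m, ε₀, Δx > 0, then Σ_{j=1}^{N} F_j ρ_j = 0. -/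
/-- Each summand is the difference of the squares of two consecutive forward differences, so the
sum telescopes. -/
theorem sum_second_diff_mul_central_diff {R : Type*} [CommRing R] (ψ : ℕ → R) (N : ℕ) :
    ∑ j ∈ Finset.Icc 1 N,
      (ψ (j + 1) - 2 * ψ j + ψ (j - 1)) * (ψ (j + 1) - ψ (j - 1)) =
      (ψ (N + 1) - ψ N) ^ 2 - (ψ 1 - ψ 0) ^ 2 := by
  induction N with
  | zero => simp
  | succ n ih =>
    rw [Finset.sum_Icc_succ_top (Nat.le_add_left 1 n), ih, Nat.add_sub_cancel]
    ring

/-- Discrete summation-by-parts identity for the central-difference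
discretization of the Poisson equation under periodic boundary conditions,
and the resulting vanishing of the net discrete electric force. -/
theorem discrete_force_identity
    (N : ℕ) (hN : 1 ≤ N) (ψ : ℕ → ℝ)
    (hper0 : ψ 0 = ψ N) (hperN : ψ (N + 1) = ψ 1) :
    (∑ j ∈ Finset.Icc 1 N,
      (ψ (j + 1) - 2 * ψ j + ψ (j - 1)) * (ψ (j + 1) - ψ (j - 1))) = 0 ∧
    ∀ (q m ε₀ Δx : ℝ), 0 < q → 0 < m → 0 < ε₀ → 0 < Δx →
      ∀ ρ F : ℕ → ℝ,
        (∀ j, ρ j = -(ε₀ / q) * (ψ (j + 1) - 2 * ψ j + ψ (j - 1)) / Δx ^ 2) →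
        (∀ j, F j = -(q / m) * (ψ (j + 1) - ψ (j - 1)) / (2 * Δx)) →
        (∑ j ∈ Finset.Icc 1 N, F j * ρ j) = 0 := by
  have h : ∑ j ∈ Finset.Icc 1 N,
      (ψ (j + 1) - 2 * ψ j + ψ (j - 1)) * (ψ (j + 1) - ψ (j - 1)) = 0 := by
    rw [sum_second_diff_mul_central_diff, hperN, hper0, sub_self]
  refine ⟨h, fun q m ε₀ Δx _ _ _ _ ρ F hρ hF => ?_⟩
  calc ∑ j ∈ Finset.Icc 1 N, F j * ρ j
      = ∑ j ∈ Finset.Icc 1 N, (q / m) * (ε₀ / q) / (2 * Δx * Δx ^ 2) *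
          ((ψ (j + 1) - 2 * ψ j + ψ (j - 1)) * (ψ (j + 1) - ψ (j - 1))) :=
        Finset.sum_congr rfl fun j _ => by rw [hρ, hF]; ring
    _ = 0 := by rw [← Finset.mul_sum, h, mul_zero]
end
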